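/- arXiv:2102.07948 — 2 statements merged into one kernel-verified Lean document; each statement's English description precedes it below -/
import Mathlib

section
/- Let k be a positive integer and G a finite simple graph with chromatic number at most k. If φ1 and φ2 are proper (k+1)-colorings of G that contain monochromatic k-good templates T1 and T2 respectively, then φ1 and φ2 are Kempe (k+1)-equivalent. -/
namespace KempePaper

variable {V : Type*}

/-- A proper `k`-coloring: adjacent vertices receive distinct colors. -/
def Proper (G : SimpleGraph V) {k : ℕ} (c : V → Fin k) : Prop :=
  ∀ ⦃u v : V⦄, G.Adj u v → c u ≠ c v

/-- The subgraph of `G` induced by the vertices colored `α` or `β` under `c`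
(as a graph on all of `V`, with edges only between such vertices). -/
def kempeGraph (G : SimpleGraph V) {k : ℕ} (c : V → Fin k) (α β : Fin k) :
    SimpleGraph V :=
  SimpleGraph.fromRel (fun u v =>
    G.Adj u v ∧ (c u = α ∨ c u = β) ∧ (c v = α ∨ c v = β))

/-- `c₂` is obtained from `c₁` by a single Kempe swap: the colors `α` and `β`
are interchanged on the connected component (of the subgraph induced by the
vertices colored `α` or `β`) containing some vertex `w`, and nothing else changes. -/
def KempeStep (G : SimpleGraph V) {k : ℕ} (c₁ c₂ : V → Fin k) : Prop :=
  ∃ (α β : Fin k) (w : V),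
    (∀ v : V, (kempeGraph G c₁ α β).Reachable w v → c₂ v = Equiv.swap α β (c₁ v)) ∧
    (∀ v : V, ¬ (kempeGraph G c₁ α β).Reachable w v → c₂ v = c₁ v)

/-- Two `k`-colorings are Kempe `k`-equivalent if one can be obtained from the
other by a finite sequence of Kempe swaps. -/
def KempeEquiv (G : SimpleGraph V) {k : ℕ} (c₁ c₂ : V → Fin k) : Prop :=
  Relation.ReflTransGen (KempeStep G) c₁ c₂

/-- The triangulated toroidal grid `T[a×b]`. -/
def triGrid (a b : ℕ) : SimpleGraph (ZMod a × ZMod b) :=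
  SimpleGraph.fromRel (fun u v =>
    u - v ∈ ({(0,1), (0,-1), (1,0), (-1,0), (1,-1), (-1,1)} : Set (ZMod a × ZMod b)))

/-- `G` is `d`-degenerate: every nonempty finite set `S` of vertices contains a
vertex with at most `d` neighbors inside `S`. -/
def Degenerate (G : SimpleGraph V) (d : ℕ) : Prop :=
  ∀ S : Set V, S.Finite → S.Nonempty → ∃ v ∈ S, (S ∩ G.neighborSet v).ncard ≤ d

/-- `S` is an independent set in `G`. -/
def Indep (G : SimpleGraph V) (S : Set V) : Prop :=
  ∀ u ∈ S, ∀ v ∈ S, ¬ G.Adj u v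

/-- The relation identifying all the vertices of `S`. -/
def identifyRel (S : Set V) (u v : V) : Prop :=
  u = v ∨ (u ∈ S ∧ v ∈ S)

/-- The identification `G/S`: the vertices of `S` are merged into a single vertex,
and two distinct resulting vertices are adjacent iff some representatives are
adjacent in `G`. -/
def Identify (G : SimpleGraph V) (S : Set V) :
    SimpleGraph (Quot (identifyRel S)) :=
  SimpleGraph.fromRel (fun x y =>
    ∃ u v : V, Quot.mk (identifyRel S) u = x ∧ Quot.mk (identifyRel S) v = y ∧ G.Adj u v)

/-- A good 4-template: an independent set of exactly 4 vertices whose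
identification yields a 4-degenerate graph. -/
def GoodFourTemplate (G : SimpleGraph V) (S : Set V) : Prop :=
  Indep G S ∧ S.ncard = 4 ∧ Degenerate (Identify G S) 4

/-- A coloring is monochromatic on `S`. -/
def Mono {k : ℕ} (c : V → Fin k) (S : Set V) : Prop :=
  ∀ u ∈ S, ∀ v ∈ S, c u = c v

/-- `φ` is nice: it is Kempe 5-equivalent to a proper 5-coloring of `T[a×b]`
containing a good 4-template. -/
def Nice (a b : ℕ) (c : ZMod a × ZMod b → Fin 5) : Prop :=
  ∃ c' : ZMod a × ZMod b → Fin 5,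
    Proper (triGrid a b) c' ∧ KempeEquiv (triGrid a b) c c' ∧
    ∃ S : Set (ZMod a × ZMod b), GoodFourTemplate (triGrid a b) S ∧ Mono c' S

/-- The relation identifying the vertices within each color of the template `T`. -/
def contractRel (T : Set (Set V)) (u v : V) : Prop :=
  u = v ∨ ∃ C ∈ T, u ∈ C ∧ v ∈ C

/-- The contraction `G_T`: the vertices within each color of `T` are identified,
and two distinct resulting vertices are adjacent iff some representatives are
adjacent in `G`. -/
def Contract (G : SimpleGraph V) (T : Set (Set V)) :
    SimpleGraph (Quot (contractRel T)) :=
  SimpleGraph.fromRel (fun x y =>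
    ∃ u v : V, Quot.mk (contractRel T) u = x ∧ Quot.mk (contractRel T) v = y ∧ G.Adj u v)

/-- `T` is a template in `G`: a finite collection of pairwise disjoint nonempty
independent sets of vertices. -/
def IsTemplate (G : SimpleGraph V) (T : Set (Set V)) : Prop :=
  T.Finite ∧ (∀ C ∈ T, C.Nonempty) ∧ T.Pairwise (fun C D => Disjoint C D) ∧
    ∀ C ∈ T, Indep G C

/-- A coloring contains the template `T` if each color of `T` is monochromatic. -/
def ContainsTemplate {k : ℕ} (c : V → Fin k) (T : Set (Set V)) : Prop :=
  ∀ C ∈ T, Mono c C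


open Classical in
/-- Exchange the colors `α` and `β` on the set `K`. -/
noncomputable def swapOn {k : ℕ} (c : V → Fin k) (α β : Fin k) (K : Set V) : V → Fin k :=
  fun v => if v ∈ K then Equiv.swap α β (c v) else c v

/-- `K` is a union of components of the `α`/`β`-subgraph, up to vertices of other colors. -/
def KempeClosed (G : SimpleGraph V) {k : ℕ} (c : V → Fin k) (α β : Fin k) (K : Set V) : Prop :=
  ∀ u ∈ K, ∀ v, G.Adj u v → (c u = α ∨ c u = β) → (c v = α ∨ c v = β) → v ∈ K

/-- The spanning subgraph of `G` consisting of the edges with both ends in `S`. -/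
def edgesWithin (G : SimpleGraph V) (S : Set V) : SimpleGraph V where
  Adj u v := G.Adj u v ∧ u ∈ S ∧ v ∈ S
  symm := ⟨fun _ _ h => ⟨h.1.symm, h.2.2, h.2.1⟩⟩
  loopless := ⟨fun _ h => h.1.ne rfl⟩

lemma swap_mem_pair_iff {k : ℕ} (α β x : Fin k) :
    (Equiv.swap α β x = α ∨ Equiv.swap α β x = β) ↔ (x = α ∨ x = β) := by
  rw [Equiv.swap_apply_def]
  split_ifs <;> simp_all

lemma swapOn_mem_pair_iff {k : ℕ} (c : V → Fin k) (α β : Fin k) (K : Set V) (v : V) :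
    (swapOn c α β K v = α ∨ swapOn c α β K v = β) ↔ (c v = α ∨ c v = β) := by
  unfold swapOn
  split_ifs
  · exact swap_mem_pair_iff ..
  · rfl

lemma swapOn_swapOn {k : ℕ} (c : V → Fin k) (α β : Fin k) (K : Set V) :
    swapOn (swapOn c α β K) α β K = c := by
  funext v
  by_cases h : v ∈ K <;> simp [swapOn, h]

lemma KempeClosed.swapOn {G : SimpleGraph V} {k : ℕ} {c : V → Fin k} {α β : Fin k} {K : Set V}
    (h : KempeClosed G c α β K) (L : Set V) :
    KempeClosed G (KempePaper.swapOn c α β L) α β K := by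
  intro u hu v huv h1 h2
  rw [swapOn_mem_pair_iff] at h1 h2
  exact h u hu v huv h1 h2

lemma KempeClosed.proper_swapOn {G : SimpleGraph V} {k : ℕ} {c : V → Fin k} {α β : Fin k}
    {K : Set V} (h : KempeClosed G c α β K) (hc : Proper G c) :
    Proper G (KempePaper.swapOn c α β K) := by
  have key : ∀ u v, G.Adj u v → u ∈ K → v ∉ K → Equiv.swap α β (c u) ≠ c v := by
    intro u v huv hu hv heq
    by_cases h1 : c u = α ∨ c u = β
    · have h2 := (swap_mem_pair_iff α β (c u)).2 h1
      rw [heq] at h2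
      exact hv (h u hu v huv h1 h2)
    · push Not at h1
      rw [Equiv.swap_apply_of_ne_of_ne h1.1 h1.2] at heq
      exact hc huv heq
  intro u v huv
  unfold KempePaper.swapOn
  split_ifs with hu hv hv
  · exact fun heq => hc huv ((Equiv.swap α β).injective heq)
  · exact key u v huv hu hv
  · exact (key v u huv.symm hv hu).symm
  · exact hc huv

lemma kempeGraph_adj {G : SimpleGraph V} {k : ℕ} {c : V → Fin k} {α β : Fin k} {u v : V} :
    (kempeGraph G c α β).Adj u v ↔
      G.Adj u v ∧ (c u = α ∨ c u = β) ∧ (c v = α ∨ c v = β) := by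
  rw [kempeGraph, SimpleGraph.fromRel_adj]
  constructor
  · rintro ⟨-, h | ⟨h1, h2, h3⟩⟩
    · exact h
    · exact ⟨h1.symm, h3, h2⟩
  · exact fun h => ⟨h.1.ne, Or.inl h⟩

lemma kempeClosed_reachable (G : SimpleGraph V) {k : ℕ} (c : V → Fin k) (α β : Fin k) (w : V) :
    KempeClosed G c α β {v | (kempeGraph G c α β).Reachable w v} := fun _ hu _ huv h1 h2 =>
  SimpleGraph.Reachable.trans hu (SimpleGraph.Adj.reachable (kempeGraph_adj.2 ⟨huv, h1, h2⟩))

lemma KempeStep.exists_eq_swapOn {G : SimpleGraph V} {k : ℕ} {c₁ c₂ : V → Fin k}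
    (h : KempeStep G c₁ c₂) : ∃ α β K, KempeClosed G c₁ α β K ∧ c₂ = swapOn c₁ α β K := by
  obtain ⟨α, β, w, h1, h2⟩ := h
  refine ⟨α, β, _, kempeClosed_reachable G c₁ α β w, funext fun v => ?_⟩
  by_cases hv : (kempeGraph G c₁ α β).Reachable w v
  · simp [swapOn, hv, h1 v hv]
  · simp [swapOn, hv, h2 v hv]

lemma kempeStep_swapOn_reachable (G : SimpleGraph V) {k : ℕ} (c : V → Fin k) (α β : Fin k)
    (w : V) : KempeStep G c (swapOn c α β {v | (kempeGraph G c α β).Reachable w v}) :=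
  ⟨α, β, w, fun v hv => by simp [swapOn, hv], fun v hv => by simp [swapOn, hv]⟩

lemma KempeClosed.kempeEquiv_swapOn [Finite V] {G : SimpleGraph V} {k : ℕ} {c : V → Fin k}
    {α β : Fin k} {K : Set V} (h : KempeClosed G c α β K) :
    KempeEquiv G c (KempePaper.swapOn c α β K) := by
  induction hn : K.ncard using Nat.strong_induction_on generalizing K c with
  | _ n ih =>
    rcases K.eq_empty_or_nonempty with rfl | ⟨w, hw⟩
    · have : KempePaper.swapOn c α β ∅ = c := by funext v; simp [KempePaper.swapOn]
      rw [this]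
      exact Relation.ReflTransGen.refl
    · set D : Set V := {v | (kempeGraph G c α β).Reachable w v}
      have hwD : w ∈ D := SimpleGraph.Reachable.refl w
      have hDK : D ⊆ K := by
        intro v hv
        replace hv := (SimpleGraph.reachable_iff_reflTransGen w v).1 hv
        induction hv with
        | refl => exact hw
        | tail _ hadj hmem =>
          obtain ⟨h1, h2, h3⟩ := kempeGraph_adj.1 hadj
          exact h _ hmem _ h1 h2 h3
      have hdiff : KempeClosed G c α β (K \ D) := by
        intro u hu v huv h1 h2
        exact ⟨h u hu.1 v huv h1 h2, fun hv =>
          hu.2 (kempeClosed_reachable G c α β w v hv u huv.symm h2 h1)⟩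
      have hlt : (K \ D).ncard < n := by
        rw [← hn]
        exact Set.ncard_lt_ncard ⟨Set.sdiff_subset, fun hs => (hs hw).2 hwD⟩ (Set.toFinite _)
      have heq : KempePaper.swapOn (KempePaper.swapOn c α β D) α β (K \ D)
          = KempePaper.swapOn c α β K := by
        funext v
        by_cases hvD : v ∈ D
        · simp [KempePaper.swapOn, hvD, hDK hvD]
        · have hmem : v ∈ K \ D ↔ v ∈ K := and_iff_left hvD
          by_cases hvK : v ∈ K
          · simp only [KempePaper.swapOn, if_neg hvD, if_pos hvK, if_pos (hmem.2 hvK)]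
          · simp only [KempePaper.swapOn, if_neg hvD, if_neg hvK, if_neg (mt hmem.1 hvK)]
      rw [← heq]
      exact Relation.ReflTransGen.head (kempeStep_swapOn_reachable G c α β w)
        (ih _ hlt (hdiff.swapOn D) rfl)

lemma KempeEquiv.symm [Finite V] {G : SimpleGraph V} {k : ℕ} {c₁ c₂ : V → Fin k}
    (h : KempeEquiv G c₁ c₂) : KempeEquiv G c₂ c₁ := by
  induction h with
  | refl => exact Relation.ReflTransGen.refl
  | tail _ hstep ih =>
    obtain ⟨α, β, K, hK, rfl⟩ := hstep.exists_eq_swapOn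
    have h := (hK.swapOn K).kempeEquiv_swapOn
    rw [swapOn_swapOn] at h
    exact Relation.ReflTransGen.trans h ih

open Classical in
lemma Proper.update {G : SimpleGraph V} {k : ℕ} {c : V → Fin k} (hc : Proper G c) {v : V}
    {γ : Fin k} (hγ : ∀ u, G.Adj v u → c u ≠ γ) : Proper G (Function.update c v γ) := by
  intro x y hxy
  by_cases hx : x = v
  · subst hx
    simpa [Function.update_of_ne hxy.ne'] using (hγ y hxy).symm
  · by_cases hy : y = v
    · subst hy
      simpa [Function.update_of_ne hx] using hγ x hxy.symm
    · simpa [Function.update_of_ne hx, Function.update_of_ne hy] using hc hxy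

open Classical in
lemma Proper.kempeEquiv_update [Finite V] {G : SimpleGraph V} {k : ℕ} {c : V → Fin k}
    (hc : Proper G c) {v : V} {γ : Fin k} (hγ : ∀ u, G.Adj v u → c u ≠ γ) :
    KempeEquiv G c (Function.update c v γ) := by
  have hK : KempeClosed G c (c v) γ {v} := by
    rintro u rfl w huw - (h | h)
    · exact absurd h.symm (hc huw)
    · exact absurd h (hγ w huw)
  have heq : swapOn c (c v) γ {v} = Function.update c v γ := by
    funext u
    by_cases hu : u = v
    · subst hu; simp [swapOn]
    · simp [swapOn, hu]
  rw [← heq]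
  exact hK.kempeEquiv_swapOn

/-- If every color other than `α` and `β` appears among at most `k` neighbors, at most one of
these neighbors has color `α` or `β`. -/
lemma eq_of_color_mem_pair [Finite V] {k : ℕ} {N : Set V} (hN : N.ncard ≤ k)
    (d : V → Fin (k + 1)) {α β : Fin (k + 1)}
    (hall : ∀ γ, γ ≠ α → γ ≠ β → ∃ u ∈ N, d u = γ) {x y : V} (hx : x ∈ N) (hy : y ∈ N)
    (hdx : d x = α ∨ d x = β) (hdy : d y = α ∨ d y = β) : x = y := by
  by_contra hxy
  have hsub : ({α, β}ᶜ : Set (Fin (k + 1))) ⊆ d '' (N \ {x, y}) := by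
    intro γ hγ
    simp only [Set.mem_compl_iff, Set.mem_insert_iff, Set.mem_singleton_iff, not_or] at hγ
    obtain ⟨u, hu, rfl⟩ := hall γ hγ.1 hγ.2
    refine ⟨u, ⟨hu, ?_⟩, rfl⟩
    rintro (rfl | rfl) <;> tauto
  have h1 := Set.ncard_le_ncard hsub (Set.toFinite _)
  have h2 := Set.ncard_image_le (f := d) (Set.toFinite (N \ {x, y}))
  have h3 := Set.ncard_sdiff_add_ncard_of_subset (s := {x, y}) (t := N)
    (by rintro z (rfl | rfl) <;> assumption)
  have h4 := Set.ncard_add_ncard_compl ({α, β} : Set (Fin (k + 1)))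
  have h5 := Set.ncard_insert_le α ({β} : Set (Fin (k + 1)))
  rw [Set.ncard_pair hxy] at h3
  rw [Set.ncard_singleton] at h5
  rw [Nat.card_eq_fintype_card, Fintype.card_fin] at h4
  omega

open Classical in
/-- A Kempe swap in a graph obtained by forgetting edges at a vertex `v` of degree at most `k`
can be lifted, up to the color of `v`. -/
lemma KempeStep.exists_lift [Finite V] {H H' : SimpleGraph V} {k : ℕ} {v : V}
    (hH : ∀ x y, x ≠ v → y ≠ v → H.Adj x y → H'.Adj x y) (hdeg : (H.neighborSet v).ncard ≤ k)
    {c₁ c₂ d₁ : V → Fin (k + 1)} (hstep : KempeStep H' c₁ c₂) (hd₁ : Proper H d₁)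
    (hcd : ∀ u, u ≠ v → d₁ u = c₁ u) :
    ∃ d₂, Proper H d₂ ∧ KempeEquiv H d₁ d₂ ∧ ∀ u, u ≠ v → d₂ u = c₂ u := by
  obtain ⟨α, β, K, hK, rfl⟩ := hstep.exists_eq_swapOn
  by_cases hex : ∃ γ, γ ≠ α ∧ γ ≠ β ∧ ∀ u, H.Adj v u → d₁ u ≠ γ
  · obtain ⟨γ, hγα, hγβ, hγ⟩ := hex
    have hcl : KempeClosed H (Function.update d₁ v γ) α β (K \ {v}) := by
      intro x hx y hxy h1 h2
      have hxv : x ≠ v := hx.2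
      by_cases hyv : y = v
      · subst hyv
        simp [hγα, hγβ] at h2
      · rw [Function.update_of_ne hxv, hcd x hxv] at h1
        rw [Function.update_of_ne hyv, hcd y hyv] at h2
        exact ⟨hK x hx.1 y (hH x y hxv hyv hxy) h1 h2, hyv⟩
    refine ⟨_, hcl.proper_swapOn (hd₁.update hγ),
      (hd₁.kempeEquiv_update hγ).trans hcl.kempeEquiv_swapOn, fun u hu => ?_⟩
    simp [swapOn, hu, hcd u hu]
  · push Not at hex
    have huniq : ∀ x y, H.Adj v x → H.Adj v y → (d₁ x = α ∨ d₁ x = β) →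
        (d₁ y = α ∨ d₁ y = β) → x = y := fun x y hx hy =>
      eq_of_color_mem_pair hdeg d₁ hex hx hy
    suffices ∃ L, KempeClosed H d₁ α β L ∧ ∀ u, u ≠ v → (u ∈ L ↔ u ∈ K) by
      obtain ⟨L, hL, hLK⟩ := this
      refine ⟨_, hL.proper_swapOn hd₁, hL.kempeEquiv_swapOn, fun u hu => ?_⟩
      simp [swapOn, hLK u hu, hcd u hu]
    have hoff : ∀ x ∈ K, x ≠ v → ∀ y, y ≠ v → H.Adj x y → (d₁ x = α ∨ d₁ x = β) →
        (d₁ y = α ∨ d₁ y = β) → y ∈ K := by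
      intro x hx hxv y hyv hxy h1 h2
      rw [hcd x hxv] at h1
      rw [hcd y hyv] at h2
      exact hK x hx y (hH x y hxv hyv hxy) h1 h2
    by_cases hx : ∃ x ∈ K, H.Adj v x ∧ (d₁ x = α ∨ d₁ x = β)
    · obtain ⟨x, hxK, hvx, hdx⟩ := hx
      refine ⟨insert v K, ?_, fun u hu => by simp [hu]⟩
      intro y hy z hyz h1 h2
      by_cases hzv : z = v
      · exact Or.inl hzv
      right
      by_cases hyv : y = v
      · subst hyv
        rwa [huniq z x hyz hvx h2 hdx]
      · exact hoff y (hy.resolve_left hyv) hyv z hzv hyz h1 h2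
    · refine ⟨K \ {v}, ?_, fun u hu => by simp [hu]⟩
      intro y hy z hyz h1 h2
      by_cases hzv : z = v
      · subst hzv
        exact absurd ⟨y, hy.1, hyz.symm, h1⟩ hx
      · exact ⟨hoff y hy.1 hy.2 z hzv hyz h1 h2, hzv⟩

lemma KempeEquiv.exists_lift [Finite V] {H H' : SimpleGraph V} {k : ℕ} {v : V}
    (hH : ∀ x y, x ≠ v → y ≠ v → H.Adj x y → H'.Adj x y) (hdeg : (H.neighborSet v).ncard ≤ k)
    {c₁ c₂ : V → Fin (k + 1)} (h : KempeEquiv H' c₁ c₂) (hc₁ : Proper H c₁) :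
    ∃ d₂, Proper H d₂ ∧ KempeEquiv H c₁ d₂ ∧ ∀ u, u ≠ v → d₂ u = c₂ u := by
  induction h with
  | refl => exact ⟨c₁, hc₁, Relation.ReflTransGen.refl, fun _ _ => rfl⟩
  | tail _ hstep ih =>
    obtain ⟨d, hd, hcd, hagree⟩ := ih
    obtain ⟨d', hd', hdd', hagree'⟩ := hstep.exists_lift hH hdeg hd hagree
    exact ⟨d', hd', hcd.trans hdd', hagree'⟩

open Classical in
lemma Degenerate.exists_kempeEquiv_eqOn [Finite V] {G : SimpleGraph V} {k : ℕ}
    (hG : Degenerate G k) (S : Set V) {c d : V → Fin (k + 1)}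
    (hc : Proper (edgesWithin G S) c) (hd : Proper (edgesWithin G S) d) :
    ∃ d', KempeEquiv (edgesWithin G S) c d' ∧ Set.EqOn d' d S := by
  induction hn : S.ncard using Nat.strong_induction_on generalizing S with
  | _ n ih =>
    rcases S.eq_empty_or_nonempty with rfl | hS
    · exact ⟨c, Relation.ReflTransGen.refl, Set.eqOn_empty _ _⟩
    obtain ⟨v, hv, hdeg⟩ := hG S (Set.toFinite S) hS
    have hlt : (S \ {v}).ncard < n := hn ▸ Set.ncard_sdiff_singleton_lt_of_mem hv
    have hmono : ∀ f : V → Fin (k + 1), Proper (edgesWithin G S) f →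
        Proper (edgesWithin G (S \ {v})) f :=
      fun f hf x y hxy => hf ⟨hxy.1, hxy.2.1.1, hxy.2.2.1⟩
    obtain ⟨d', hcd', hd'⟩ := ih _ hlt (S \ {v}) (hmono c hc) (hmono d hd) rfl
    have hdeg' : ((edgesWithin G S).neighborSet v).ncard ≤ k :=
      (Set.ncard_le_ncard (fun _ (hu : (edgesWithin G S).Adj _ _) =>
        Set.mem_inter hu.2.2 hu.1) (Set.toFinite _)).trans hdeg
    obtain ⟨e, he, hce, hed'⟩ := KempeEquiv.exists_lift (v := v) (H := edgesWithin G S)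
      (H' := edgesWithin G (S \ {v}))
      (fun x y hx hy h => ⟨h.1, ⟨h.2.1, hx⟩, ⟨h.2.2, hy⟩⟩) hdeg' hcd' hc
    have hagree : ∀ u ∈ S, u ≠ v → e u = d u := fun u hu huv =>
      (hed' u huv).trans (hd' ⟨hu, huv⟩)
    refine ⟨Function.update e v (d v), hce.trans (he.kempeEquiv_update fun u hu => ?_), ?_⟩
    · rw [hagree u hu.2.2 hu.ne']
      exact (hd hu).symm
    · intro u hu
      by_cases huv : u = v
      · subst huv; simp
      · rw [Function.update_of_ne huv, hagree u hu huv]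

/-- Las Vergnas and Meyniel: all `(k+1)`-colorings of a `k`-degenerate graph are equivalent. -/
theorem Degenerate.kempeEquiv [Finite V] {G : SimpleGraph V} {k : ℕ} (hG : Degenerate G k)
    {c d : V → Fin (k + 1)} (hc : Proper G c) (hd : Proper G d) : KempeEquiv G c d := by
  have huniv : edgesWithin G Set.univ = G := by ext; simp [edgesWithin]
  obtain ⟨d', h, hd'⟩ := hG.exists_kempeEquiv_eqOn Set.univ (huniv.symm ▸ hc) (huniv.symm ▸ hd)
  rw [huniv, Set.eqOn_univ d' d |>.1 hd'] at h
  exact h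

lemma KempeEquiv.comp {W : Type*} [Finite V] {G : SimpleGraph V} {H : SimpleGraph W} (f : G →g H)
    {k : ℕ} {c d : W → Fin k} (h : KempeEquiv H c d) : KempeEquiv G (c ∘ f) (d ∘ f) := by
  induction h with
  | refl => exact Relation.ReflTransGen.refl
  | @tail b _ _ hstep ih =>
    obtain ⟨α, β, K, hK, rfl⟩ := hstep.exists_eq_swapOn
    have hcl : KempeClosed G (b ∘ f) α β (f ⁻¹' K) :=
      fun u hu v huv h1 h2 => hK (f u) hu (f v) (f.map_adj huv) h1 h2
    exact ih.trans hcl.kempeEquiv_swapOn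

lemma contractRel_singleton_equivalence (C : Set V) :
    Equivalence (contractRel ({C} : Set (Set V))) where
  refl _ := Or.inl rfl
  symm := by
    rintro x y (rfl | ⟨D, hD, hx, hy⟩)
    · exact Or.inl rfl
    · exact Or.inr ⟨D, hD, hy, hx⟩
  trans := by
    rintro x y z (rfl | ⟨D, hD, hx, hy⟩) (rfl | ⟨E, hE, hy', hz⟩)
    · exact Or.inl rfl
    · exact Or.inr ⟨E, hE, hy', hz⟩
    · exact Or.inr ⟨D, hD, hx, hy⟩
    · rw [Set.mem_singleton_iff] at hD hE
      subst hD hE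
      exact Or.inr ⟨_, rfl, hx, hz⟩

/-- The projection onto the contraction of an independent set. -/
def contractHom {G : SimpleGraph V} {C : Set V} (hC : Indep G C) : G →g Contract G {C} where
  toFun := Quot.mk (contractRel {C})
  map_rel' := by
    intro u v huv
    rw [Contract, SimpleGraph.fromRel_adj]
    refine ⟨fun heq => ?_, Or.inl ⟨u, v, rfl, rfl, huv⟩⟩
    rcases Quot.eqvGen_exact heq |> (contractRel_singleton_equivalence C).eqvGen_iff.1 with
      h | ⟨D, hD, hu, hv⟩
    · exact huv.ne h
    · rw [Set.mem_singleton_iff] at hD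
      subst hD
      exact hC u hu v hv huv

lemma Mono.exists_contract_coloring {G : SimpleGraph V} {C : Set V} (hC : Indep G C) {k : ℕ}
    {c : V → Fin k} (hc : Proper G c) (hmono : Mono c C) :
    ∃ c' : Quot (contractRel {C}) → Fin k, Proper (Contract G {C}) c' ∧
      c' ∘ contractHom hC = c := by
  have hresp : ∀ u v, contractRel {C} u v → c u = c v := by
    rintro u v (rfl | ⟨D, hD, hu, hv⟩)
    · rfl
    · rw [Set.mem_singleton_iff] at hD
      subst hD
      exact hmono u hu v hv
  refine ⟨Quot.lift c hresp, fun x y hxy => ?_, rfl⟩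
  rw [Contract, SimpleGraph.fromRel_adj] at hxy
  rcases hxy.2 with ⟨u, v, rfl, rfl, huv⟩ | ⟨u, v, rfl, rfl, huv⟩
  · exact hc huv
  · exact (hc huv).symm

lemma kempeEquiv_of_mono [Finite V] {G : SimpleGraph V} {C : Set V} (hC : Indep G C) {k : ℕ}
    (hgood : Degenerate (Contract G {C}) k) {c d : V → Fin (k + 1)} (hc : Proper G c)
    (hd : Proper G d) (hcC : Mono c C) (hdC : Mono d C) : KempeEquiv G c d := by
  obtain ⟨c', hc', rfl⟩ := hcC.exists_contract_coloring hC hc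
  obtain ⟨d', hd', rfl⟩ := hdC.exists_contract_coloring hC hd
  exact (hgood.kempeEquiv hc' hd').comp (contractHom hC)

open Classical in
/-- The `(k+1)`-coloring that uses the extra color on `C` and follows `c` elsewhere. -/
noncomputable def freshOn {k : ℕ} (c : V → Fin k) (C : Set V) : V → Fin (k + 1) :=
  fun v => if v ∈ C then Fin.last k else (c v).castSucc

lemma Proper.freshOn {G : SimpleGraph V} {k : ℕ} {c : V → Fin k} (hc : Proper G c) {C : Set V}
    (hC : Indep G C) : Proper G (KempePaper.freshOn c C) := by
  intro u v huv
  unfold KempePaper.freshOn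
  split_ifs with hu hv hv
  · exact absurd huv (hC u hu v hv)
  · exact (Fin.castSucc_lt_last _).ne'
  · exact (Fin.castSucc_lt_last _).ne
  · exact fun h => hc huv (Fin.castSucc_injective k h)

lemma mono_freshOn {k : ℕ} (c : V → Fin k) (C : Set V) : Mono (freshOn c C) C :=
  fun u hu v hv => by simp [freshOn, hu, hv]

lemma kempeEquiv_freshOn [Finite V] {G : SimpleGraph V} {k : ℕ} {c : V → Fin k}
    (hc : Proper G c) {C : Set V} (hC : Indep G C) :
    KempeEquiv G (freshOn c C) (Fin.castSucc ∘ c) := by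
  classical
  induction C, C.toFinite using Set.Finite.induction_on with
  | empty =>
    have : freshOn c ∅ = Fin.castSucc ∘ c := by funext v; simp [freshOn]
    rw [this]
    exact Relation.ReflTransGen.refl
  | @insert v C hv _ ih =>
    have heq : Function.update (freshOn c (insert v C)) v (c v).castSucc = freshOn c C := by
      funext u
      by_cases hu : u = v
      · subst hu; simp [freshOn, hv]
      · simp [freshOn, hu]
    have hstep := (hc.freshOn hC).kempeEquiv_update (v := v) (γ := (c v).castSucc) (by
      intro u huv
      unfold freshOn
      split_ifs with hu
      · exact (Fin.castSucc_lt_last _).ne'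
      · exact fun h => hc huv (Fin.castSucc_injective k h).symm)
    rw [heq] at hstep
    exact hstep.trans (ih fun x hx y hy => hC x (Or.inr hx) y (Or.inr hy))

lemma kempeEquiv_castSucc_of_mono [Finite V] {G : SimpleGraph V} {k : ℕ} {c : V → Fin k}
    (hc : Proper G c) {C : Set V} (hC : Indep G C) (hgood : Degenerate (Contract G {C}) k)
    {φ : V → Fin (k + 1)} (hφ : Proper G φ) (hmono : Mono φ C) :
    KempeEquiv G φ (Fin.castSucc ∘ c) :=
  (kempeEquiv_of_mono hC hgood hφ (hc.freshOn hC) hmono (mono_freshOn c C)).trans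
    (kempeEquiv_freshOn hc hC)

/-- If `G` has chromatic number at most `k` and `φ₁, φ₂` are proper
`(k+1)`-colorings containing monochromatic `k`-good templates `T₁, T₂`
respectively, then `φ₁` and `φ₂` are Kempe `(k+1)`-equivalent. -/
theorem statement_5 {V : Type*} [Fintype V] (G : SimpleGraph V) (k : ℕ) (hk : 0 < k)
    (hcol : ∃ c : V → Fin k, Proper G c)
    (T₁ T₂ : Set (Set V))
    (hT₁ : IsTemplate G T₁) (hmono₁ : ∃ C, T₁ = {C})
    (hgood₁ : Degenerate (Contract G T₁) k)
    (hT₂ : IsTemplate G T₂) (hmono₂ : ∃ C, T₂ = {C})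
    (hgood₂ : Degenerate (Contract G T₂) k)
    (φ₁ φ₂ : V → Fin (k + 1)) (h₁ : Proper G φ₁) (h₂ : Proper G φ₂)
    (hc₁ : ContainsTemplate φ₁ T₁) (hc₂ : ContainsTemplate φ₂ T₂) :
    KempeEquiv G φ₁ φ₂ := by
  obtain ⟨c, hc⟩ := hcol
  obtain ⟨C₁, rfl⟩ := hmono₁
  obtain ⟨C₂, rfl⟩ := hmono₂
  have e₁ := kempeEquiv_castSucc_of_mono hc (hT₁.2.2.2 C₁ rfl) hgood₁ h₁ (hc₁ C₁ rfl)
  have e₂ := kempeEquiv_castSucc_of_mono hc (hT₂.2.2.2 C₂ rfl) hgood₂ h₂ (hc₂ C₂ rfl)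
  exact e₁.trans e₂.symm

end KempePaper
end

section
/- For all integers a ≥ 7 and b ≥ 7, the set S = {(−1,0), (0,1), (1,−1), (2,1)} (with coordinates taken in (ZMod a) × (ZMod b)) is an independent set in the triangulated toroidal grid T[a×b], and the identification T[a×b]/S is 4-degenerate; that is, S is a good 4-template in T[a×b]. -/
namespace KempePaper

variable {V : Type*}

/-- The template `{(-1, 0), (0, 1), (1, -1), (2, 1)}` in the torus. -/
abbrev template (a b : ℕ) : Set (ZMod a × ZMod b) :=
  {(-1, 0), (0, 1), (1, -1), (2, 1)}

/-- The six offsets to the neighbors of a vertex of the triangular grid. -/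
def gridOffsets : Finset (ℤ × ℤ) :=
  {(0, 1), (0, -1), (1, 0), (-1, 0), (1, -1), (-1, 1)}

/-- The image in `T[a×b]/S` of the point of the torus with integer coordinates `p`. -/
def gridPoint {a b : ℕ} (S : Set (ZMod a × ZMod b)) (p : ℤ × ℤ) : Quot (identifyRel S) :=
  Quot.mk _ ((p.1 : ZMod a), (p.2 : ZMod b))

theorem eq_of_quot_mk_eq {S : Set V} {u v : V} (hv : v ∉ S)
    (h : Quot.mk (identifyRel S) u = Quot.mk (identifyRel S) v) : u = v := by
  let f : Quot (identifyRel S) → Prop := Quot.lift (· = v) (by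
    rintro x y (rfl | ⟨hx, hy⟩)
    · rfl
    · exact propext ⟨fun e => absurd (e ▸ hx) hv, fun e => absurd (e ▸ hy) hv⟩)
  have hf : f (Quot.mk _ u) = f (Quot.mk _ v) := congrArg f h
  exact hf.mpr rfl

theorem intCast_eq_of_abs_lt {a : ℕ} {x y : ℤ} (h : (x : ZMod a) = y)
    (hxy : |x - y| < a) : x = y := by
  have h' : (a : ℤ) ∣ x - y := by
    rw [← ZMod.intCast_zmod_eq_zero_iff_dvd]
    simp [h]
  have := Int.eq_zero_of_abs_lt_dvd h' hxy
  omega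

theorem triGrid_adj_exists_offset {a b : ℕ} {p : ℤ × ℤ} {u : ZMod a × ZMod b}
    (h : (triGrid a b).Adj u ((p.1 : ZMod a), (p.2 : ZMod b))) :
    ∃ d ∈ gridOffsets, u = (((p + d).1 : ZMod a), ((p + d).2 : ZMod b)) := by
  obtain ⟨x, y⟩ := u
  have key : ∃ d ∈ gridOffsets, (x, y) - ((p.1 : ZMod a), (p.2 : ZMod b)) =
      ((d.1 : ZMod a), (d.2 : ZMod b)) := by
    rw [triGrid, SimpleGraph.fromRel_adj] at h
    simp only [gridOffsets, Finset.mem_insert, Finset.mem_singleton, exists_eq_or_imp,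
      exists_eq_left, Set.mem_insert_iff, Set.mem_singleton_iff, Prod.mk_sub_mk,
      Prod.mk.injEq] at h ⊢
    push_cast
    grind
  obtain ⟨d, hd, e⟩ := key
  refine ⟨d, hd, ?_⟩
  rw [sub_eq_iff_eq_add] at e
  rw [e]
  simp [add_comm]

/-- A vertex outside `S` all of whose neighbors are either outside `K` or represented by
one of at most four offsets does not lie in `K`, provided `K` has minimum degree at least 5. -/
theorem gridPoint_notMem {a b : ℕ} {S : Set (ZMod a × ZMod b)} {K : Set (Quot (identifyRel S))}
    (hK : ∀ v ∈ K, 4 < (K ∩ (Identify (triGrid a b) S).neighborSet v).ncard) {p : ℤ × ℤ}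
    (hp : ((p.1 : ZMod a), (p.2 : ZMod b)) ∉ S) (L : Finset (ℤ × ℤ)) (hL : L.card ≤ 4)
    (h : ∀ d ∈ gridOffsets,
      gridPoint S (p + d) ∉ K ∨ ∃ e ∈ L, gridPoint S (p + d) = gridPoint S (p + e)) :
    gridPoint S p ∉ K := by
  classical
  intro hpK
  refine absurd (hK _ hpK) (not_lt.mpr ?_)
  have hsub : K ∩ (Identify (triGrid a b) S).neighborSet (gridPoint S p) ⊆
      ((L.image fun e => gridPoint S (p + e) : Finset _) : Set (Quot (identifyRel S))) := by
    rintro w ⟨hwK, hw⟩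
    rw [SimpleGraph.mem_neighborSet, Identify, SimpleGraph.fromRel_adj] at hw
    have : ∃ u, Quot.mk (identifyRel S) u = w ∧
        (triGrid a b).Adj u ((p.1 : ZMod a), (p.2 : ZMod b)) := by
      obtain ⟨-, ⟨u, v, hu, hv, huv⟩ | ⟨u, v, hu, hv, huv⟩⟩ := hw
      · exact ⟨v, hv, eq_of_quot_mk_eq hp hu ▸ huv.symm⟩
      · exact ⟨u, hu, eq_of_quot_mk_eq hp hv ▸ huv⟩
    obtain ⟨u, rfl, hu⟩ := this
    obtain ⟨d, hd, rfl⟩ := triGrid_adj_exists_offset hu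
    obtain h' | ⟨e, he, h'⟩ := h d hd
    · exact absurd hwK h'
    · exact Finset.mem_coe.mpr (Finset.mem_image.mpr ⟨e, he, h'.symm⟩)
  calc _ ≤ _ := Set.ncard_le_ncard hsub (Finset.finite_toSet _)
    _ ≤ 4 := by rw [Set.ncard_coe_finset]; exact Finset.card_image_le.trans hL

/-- A vertex outside `S` with two neighbors outside `K` does not lie in `K`. -/
theorem gridPoint_notMem_of_two {a b : ℕ} {S : Set (ZMod a × ZMod b)}
    {K : Set (Quot (identifyRel S))}
    (hK : ∀ v ∈ K, 4 < (K ∩ (Identify (triGrid a b) S).neighborSet v).ncard) {p q r : ℤ × ℤ}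
    (hp : ((p.1 : ZMod a), (p.2 : ZMod b)) ∉ S)
    (hq : gridPoint S q ∉ K) (hr : gridPoint S r ∉ K)
    (hpq : q - p ∈ gridOffsets) (hpr : r - p ∈ gridOffsets) (hqr : q ≠ r) :
    gridPoint S p ∉ K := by
  have hne : q - p ≠ r - p := fun e => hqr (sub_left_injective e)
  refine gridPoint_notMem hK hp ((gridOffsets.erase (q - p)).erase (r - p)) ?_ fun d hd => ?_
  · rw [Finset.card_erase_of_mem (Finset.mem_erase.mpr ⟨hne.symm, hpr⟩),
      Finset.card_erase_of_mem hpq]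
    decide
  · by_cases h1 : d = q - p
    · left; simpa [h1] using hq
    by_cases h2 : d = r - p
    · left; simpa [h2] using hr
    · exact Or.inr ⟨d, by simp [h1, h2, hd], rfl⟩

theorem mem_template_iff {a b : ℕ} {x y : ℤ} :
    ((x : ZMod a), (y : ZMod b)) ∈ template a b ↔
      ((x : ZMod a) = (-1 : ℤ) ∧ (y : ZMod b) = (0 : ℤ)) ∨
      ((x : ZMod a) = (0 : ℤ) ∧ (y : ZMod b) = (1 : ℤ)) ∨
      ((x : ZMod a) = (1 : ℤ) ∧ (y : ZMod b) = (-1 : ℤ)) ∨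
      ((x : ZMod a) = (2 : ℤ) ∧ (y : ZMod b) = (1 : ℤ)) := by
  simp [template]

theorem notMem_template_of_column {a b : ℕ} {x y : ℤ} (h : 3 ≤ x) (h' : x ≤ a - 2) :
    ((x : ZMod a), (y : ZMod b)) ∉ template a b := by
  rw [mem_template_iff]
  rintro (⟨e, -⟩ | ⟨e, -⟩ | ⟨e, -⟩ | ⟨e, -⟩) <;>
    · have := intCast_eq_of_abs_lt e (by rw [abs_lt]; constructor <;> omega)
      omega

theorem notMem_template_of_row {a b : ℕ} {x y : ℤ} (h : 2 ≤ y) (h' : y ≤ b - 2) :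
    ((x : ZMod a), (y : ZMod b)) ∉ template a b := by
  rw [mem_template_iff]
  rintro (⟨-, e⟩ | ⟨-, e⟩ | ⟨-, e⟩ | ⟨-, e⟩) <;>
    · have := intCast_eq_of_abs_lt e (by rw [abs_lt]; constructor <;> omega)
      omega

theorem notMem_template_of_box {a b : ℕ} (ha : 7 ≤ a) (hb : 7 ≤ b) {x y : ℤ}
    (hx : -1 ≤ x ∧ x ≤ 4) (hy : -1 ≤ y ∧ y ≤ 3)
    (h : (x, y) ∉ ({(-1, 0), (0, 1), (1, -1), (2, 1)} : Set (ℤ × ℤ))) :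
    ((x : ZMod a), (y : ZMod b)) ∉ template a b := by
  rw [mem_template_iff]
  simp only [Set.mem_insert_iff, Set.mem_singleton_iff, Prod.mk.injEq] at h
  rintro (⟨e, e'⟩ | ⟨e, e'⟩ | ⟨e, e'⟩ | ⟨e, e'⟩) <;>
    · have := intCast_eq_of_abs_lt e (by rw [abs_lt]; constructor <;> omega)
      have := intCast_eq_of_abs_lt e' (by rw [abs_lt]; constructor <;> omega)
      omega

theorem gridPoint_eq_of_mem {a b : ℕ} {S : Set (ZMod a × ZMod b)} {p q : ℤ × ℤ}
    (hp : ((p.1 : ZMod a), (p.2 : ZMod b)) ∈ S) (hq : ((q.1 : ZMod a), (q.2 : ZMod b)) ∈ S) :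
    gridPoint S p = gridPoint S q :=
  Quot.sound (Or.inr ⟨hp, hq⟩)

section Peeling

variable {a b : ℕ} {K : Set (Quot (identifyRel (template a b)))}

theorem notMem_near_template (ha : 7 ≤ a) (hb : 7 ≤ b)
    (hK : ∀ v ∈ K, 4 < (K ∩ (Identify (triGrid a b) (template a b)).neighborSet v).ncard) :
    ∀ p ∈ ({(0, 0), (1, 0), (0, -1), (-1, 1), (1, 1), (2, 0), (2, -1), (3, -1), (4, -1)} :
      Finset (ℤ × ℤ)), gridPoint (template a b) p ∉ K := by
  have box {x y : ℤ} := notMem_template_of_box ha hb (x := x) (y := y)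
  have e1 : gridPoint (template a b) (0, 1) = gridPoint (template a b) (-1, 0) :=
    gridPoint_eq_of_mem (by simp [template]) (by simp [template])
  have e2 : gridPoint (template a b) (1, -1) = gridPoint (template a b) (-1, 0) :=
    gridPoint_eq_of_mem (by simp [template]) (by simp [template])
  have e3 : gridPoint (template a b) (2, 1) = gridPoint (template a b) (-1, 0) :=
    gridPoint_eq_of_mem (by simp [template]) (by simp [template])
  have h00 : gridPoint (template a b) (0, 0) ∉ K :=
    gridPoint_notMem hK (box (by simp) (by simp) (by simp))
      {(0, -1), (1, 0), (-1, 0), (-1, 1)} (by decide) (by simp [gridOffsets, e1, e2])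
  have h10 : gridPoint (template a b) (1, 0) ∉ K :=
    gridPoint_notMem hK (box (by simp) (by simp) (by simp))
      {(0, 1), (0, -1), (1, 0), (1, -1)} (by decide) (by simp [gridOffsets, e1, e2, h00])
  have h0n : gridPoint (template a b) (0, -1) ∉ K :=
    gridPoint_notMem hK (box (by simp) (by simp) (by simp))
      {(0, -1), (-1, 0), (1, -1), (-1, 1)} (by decide) (by simp [gridOffsets, e2, h00])
  have hn1 : gridPoint (template a b) (-1, 1) ∉ K :=
    gridPoint_notMem hK (box (by simp) (by simp) (by simp))
      {(0, 1), (0, -1), (-1, 0), (-1, 1)} (by decide) (by simp [gridOffsets, e1, h00])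
  have h11 : gridPoint (template a b) (1, 1) ∉ K :=
    gridPoint_notMem hK (box (by simp) (by simp) (by simp))
      {(0, 1), (1, 0), (1, -1), (-1, 1)} (by decide) (by simp [gridOffsets, e1, e3, h10])
  have h20 : gridPoint (template a b) (2, 0) ∉ K :=
    gridPoint_notMem_of_two hK (box (by simp) (by simp) (by simp)) h10 h11
      (by decide) (by decide) (by decide)
  have h2n : gridPoint (template a b) (2, -1) ∉ K :=
    gridPoint_notMem_of_two hK (box (by simp) (by simp) (by simp)) h10 h20
      (by decide) (by decide) (by decide)
  have h3n : gridPoint (template a b) (3, -1) ∉ K :=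
    gridPoint_notMem_of_two hK (box (by simp) (by simp) (by simp)) h20 h2n
      (by decide) (by decide) (by decide)
  have h30 : gridPoint (template a b) (3, 0) ∉ K :=
    gridPoint_notMem_of_two hK (box (by simp) (by simp) (by simp)) h20 h3n
      (by decide) (by decide) (by decide)
  have h4n : gridPoint (template a b) (4, -1) ∉ K :=
    gridPoint_notMem_of_two hK (box (by simp) (by simp) (by simp)) h30 h3n
      (by decide) (by decide) (by decide)
  simp only [Finset.mem_insert, Finset.mem_singleton]
  rintro p (rfl | rfl | rfl | rfl | rfl | rfl | rfl | rfl | rfl) <;> assumption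

theorem notMem_of_column (ha : 7 ≤ a) (hb : 7 ≤ b)
    (hK : ∀ v ∈ K, 4 < (K ∩ (Identify (triGrid a b) (template a b)).neighborSet v).ncard)
    {x : ℤ} (hx : 3 ≤ x) (hx' : x ≤ a - 2) (y : ℤ) : gridPoint (template a b) (x, y) ∉ K := by
  have col {x y : ℤ} := notMem_template_of_column (a := a) (b := b) (x := x) (y := y)
  have near := notMem_near_template ha hb hK
  have strip (y : ℤ) :
      gridPoint (template a b) (3, y) ∉ K ∧ gridPoint (template a b) (4, y) ∉ K := by
    induction y using Int.inductionOn' (b := -1) with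
    | zero => exact ⟨near _ (by decide), near _ (by decide)⟩
    | succ y _ ih =>
      have h := gridPoint_notMem_of_two (p := (3, y + 1)) hK
        (col (by omega) (by omega)) ih.1 ih.2
        (by simp [gridOffsets]) (by simp [gridOffsets]) (by simp)
      exact ⟨h, gridPoint_notMem_of_two (p := (4, y + 1)) hK
        (col (by omega) (by omega)) ih.2 h
        (by simp [gridOffsets]) (by simp [gridOffsets]) (by simp)⟩
    | pred y _ ih =>
      have h := gridPoint_notMem_of_two (p := (4, y - 1)) hK
        (col (by omega) (by omega)) ih.1 ih.2
        (by simp [gridOffsets]) (by simp [gridOffsets]) (by simp)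
      exact ⟨gridPoint_notMem_of_two (p := (3, y - 1)) hK
        (col (by omega) (by omega)) ih.1 h
        (by simp [gridOffsets]) (by simp [gridOffsets]) (by simp), h⟩
  induction x, hx using Int.leInduction generalizing y with
  | base => exact (strip y).1
  | succ x hx ih =>
    exact gridPoint_notMem_of_two (p := (x + 1, y)) hK (col (by omega) (by omega))
      (ih (by omega) y) (ih (by omega) (y + 1))
      (by simp [gridOffsets]) (by simp [gridOffsets]) (by simp)

theorem notMem_of_row (ha : 7 ≤ a) (hb : 7 ≤ b)
    (hK : ∀ v ∈ K, 4 < (K ∩ (Identify (triGrid a b) (template a b)).neighborSet v).ncard)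
    {y : ℤ} (hy : 2 ≤ y) (hy' : y ≤ b - 2) (x : ℤ) : gridPoint (template a b) (x, y) ∉ K := by
  have row {x y : ℤ} := notMem_template_of_row (a := a) (b := b) (x := x) (y := y)
  have strip {y : ℤ} (hy : 2 ≤ y) (hy' : y + 1 ≤ b - 2) (x : ℤ) :
      gridPoint (template a b) (x, y) ∉ K ∧ gridPoint (template a b) (x, y + 1) ∉ K := by
    induction x using Int.inductionOn' (b := 3) with
    | zero =>
      exact ⟨notMem_of_column ha hb hK (by omega) (by omega) _,
        notMem_of_column ha hb hK (by omega) (by omega) _⟩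
    | succ x _ ih =>
      have h := gridPoint_notMem_of_two (p := (x + 1, y)) hK
        (row (by omega) (by omega)) ih.1 ih.2
        (by simp [gridOffsets]) (by simp [gridOffsets]) (by simp)
      exact ⟨h, gridPoint_notMem_of_two (p := (x + 1, y + 1)) hK
        (row (by omega) (by omega)) ih.2 h
        (by simp [gridOffsets]) (by simp [gridOffsets]) (by simp)⟩
    | pred x _ ih =>
      have h := gridPoint_notMem_of_two (p := (x - 1, y + 1)) hK
        (row (by omega) (by omega)) ih.1 ih.2
        (by simp [gridOffsets]) (by simp [gridOffsets]) (by simp)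
      exact ⟨gridPoint_notMem_of_two (p := (x - 1, y)) hK
        (row (by omega) (by omega)) ih.1 h
        (by simp [gridOffsets]) (by simp [gridOffsets]) (by simp), h⟩
  by_cases h : y + 1 ≤ b - 2
  · exact (strip hy h x).1
  · simpa using (strip (y := y - 1) (by omega) (by omega) x).2

/-- Only the merged vertex can lie in a set of minimum degree at least 5. -/
theorem mk_notMem_of_notMem_template (ha : 7 ≤ a) (hb : 7 ≤ b)
    (hK : ∀ v ∈ K, 4 < (K ∩ (Identify (triGrid a b) (template a b)).neighborSet v).ncard)
    {u : ZMod a × ZMod b} (hu : u ∉ template a b) : Quot.mk _ u ∉ K := by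
  have rep {n : ℕ} (hn : 7 ≤ n) (z : ZMod n) : ∃ x : ℤ, -1 ≤ x ∧ x ≤ n - 2 ∧ (x : ZMod n) = z := by
    have : NeZero n := ⟨by omega⟩
    have := ZMod.val_lt (z + 1)
    exact ⟨(z + 1).val - 1, by omega, by omega, by simp⟩
  obtain ⟨u₁, u₂⟩ := u
  obtain ⟨x, hx, hx', rfl⟩ := rep ha u₁
  obtain ⟨y, hy, hy', rfl⟩ := rep hb u₂
  change gridPoint (template a b) (x, y) ∉ K
  by_cases hx3 : 3 ≤ x
  · exact notMem_of_column ha hb hK hx3 hx' y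
  by_cases hy2 : 2 ≤ y
  · exact notMem_of_row ha hb hK hy2 hy' x
  have near := notMem_near_template ha hb hK
  have row : gridPoint (template a b) (-1, -2) ∉ K := by
    have : gridPoint (template a b) (-1, -2) = gridPoint (template a b) (-1, b - 2) := by
      simp [gridPoint]
    rw [this]
    exact notMem_of_row ha hb hK (by omega) le_rfl _
  have corner : gridPoint (template a b) (-1, -1) ∉ K :=
    gridPoint_notMem_of_two hK
      (notMem_template_of_box ha hb (by simp) (by simp) (by simp)) row (near (0, -1) (by decide))
      (by decide) (by decide) (by decide)
  have hx2 : x ≤ 2 := by omega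
  have hy1 : y ≤ 1 := by omega
  interval_cases x <;> interval_cases y <;>
    first
    | exact corner
    | exact near _ (by decide)
    | exact absurd (by simp [template]) hu

end Peeling

theorem degenerate_identify_template {a b : ℕ} (ha : 7 ≤ a) (hb : 7 ≤ b) :
    Degenerate (Identify (triGrid a b) (template a b)) 4 := by
  rintro K - ⟨w, hw⟩
  by_contra! hK
  have merged : ∀ v ∈ K, v = gridPoint (template a b) (2, 1) := by
    intro v hv
    induction v using Quot.ind with | mk u => ?_
    by_cases hu : u ∈ template a b
    · exact Quot.sound (Or.inr ⟨hu, by simp [template]⟩)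
    · exact absurd hv (mk_notMem_of_notMem_template ha hb hK hu)
  have hempty : K ∩ (Identify (triGrid a b) (template a b)).neighborSet w = ∅ := by
    ext v
    simp only [Set.mem_inter_iff, SimpleGraph.mem_neighborSet, Set.mem_empty_iff_false,
      iff_false, not_and]
    intro hv hadj
    exact hadj.ne ((merged w hw).trans (merged v hv).symm)
  have := hK w hw
  simp [hempty] at this

theorem indep_template {a b : ℕ} (ha : 7 ≤ a) (hb : 7 ≤ b) :
    Indep (triGrid a b) (template a b) := by
  have lift : ∀ u ∈ template a b, ∃ p ∈ ({(-1, 0), (0, 1), (1, -1), (2, 1)} : Finset (ℤ × ℤ)),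
      u = ((p.1 : ZMod a), (p.2 : ZMod b)) := by
    simp [template]
  intro u hu v hv h
  obtain ⟨p, hp, rfl⟩ := lift u hu
  obtain ⟨q, hq, rfl⟩ := lift v hv
  obtain ⟨d, hd, e⟩ := triGrid_adj_exists_offset h
  have bound : ∀ p ∈ ({(-1, 0), (0, 1), (1, -1), (2, 1)} : Finset (ℤ × ℤ)),
      ∀ q ∈ ({(-1, 0), (0, 1), (1, -1), (2, 1)} : Finset (ℤ × ℤ)), ∀ d ∈ gridOffsets,
      |p.1 - (q + d).1| < 7 ∧ |p.2 - (q + d).2| < 7 ∧ p ≠ q + d := by decide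
  obtain ⟨h1, h2, h3⟩ := bound p hp q hq d hd
  rw [Prod.mk.injEq] at e
  exact h3 (Prod.ext (intCast_eq_of_abs_lt e.1 (by omega)) (intCast_eq_of_abs_lt e.2 (by omega)))

theorem ncard_template {a b : ℕ} (ha : 7 ≤ a) : (template a b).ncard = 4 := by
  classical
  have e : template a b = (({-1, 0, 1, 2} : Finset ℤ).image fun x : ℤ =>
      ((x : ZMod a), ((if x = -1 then 0 else if x = 1 then -1 else 1 : ℤ) : ZMod b)) :
      Finset _) := by
    simp [template, Set.insert_comm]
  rw [e, Set.ncard_coe_finset, Finset.card_image_of_injOn]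
  · decide
  · intro x hx y hy h
    have bound : ∀ x ∈ ({-1, 0, 1, 2} : Finset ℤ), ∀ y ∈ ({-1, 0, 1, 2} : Finset ℤ),
        |x - y| < 7 := by decide
    exact intCast_eq_of_abs_lt (congrArg Prod.fst h)
      (by have := bound x hx y hy; omega)

/-- For `a, b ≥ 7`, the set `{(−1,0), (0,1), (1,−1), (2,1)}` is a
good 4-template in `T[a×b]`: it is independent and the identification is
4-degenerate. -/
theorem statement_8 (a b : ℕ) (ha : 7 ≤ a) (hb : 7 ≤ b) :
    GoodFourTemplate (triGrid a b)
      ({(-1, 0), (0, 1), (1, -1), (2, 1)} : Set (ZMod a × ZMod b)) := by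
  exact ⟨indep_template ha hb, ncard_template ha, degenerate_identify_template ha hb⟩

end KempePaper
end
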